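/- Let π: P → H be a surjective map of Hopf algebras over a field k, B := Pᴴ, and X a crossed (H,B)-module. Then P⊗X, with the left regular P-module and left regular P-comodule structure on the factor P, the tensor product right B-module structure (p⊗x)◁b := pb₁ ⊗ x◁b₂, and the tensor product right H-comodule structure p⊗x ↦ p₁⊗x₍₀₎ ⊗ π(p₂)x₍₁₎, has all four structures pairwise compatible (it is a left P-module, left P-comodule, right H-comodule, right B-module Hopf module). -/

import Mathlib

open TensorProduct CategoryTheory

noncomputable section

/- STATEMENT 9: P ⊗ X for a crossed (H,B)-module X is a (P,P,H,B)-Hopf module. -/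

section Props
variable {k : Type} [Field k] {H : Type} [Ring H] [HopfAlgebra k H]
variable {A : Type} [Ring A] [Algebra k A]
variable {V : Type} [AddCommGroup V] [Module k V]

/-- `ρ : V → V ⊗ H` is a right `H`-comodule structure. -/
def IsRightCoaction (ρ : V →ₗ[k] V ⊗[k] H) : Prop :=
  (∀ v, (TensorProduct.rid k V)
      ((LinearMap.lTensor V (Coalgebra.counit (R := k) (A := H))) (ρ v)) = v) ∧
  (∀ v, (LinearMap.rTensor H ρ) (ρ v) =
    (TensorProduct.assoc k V H H).symm
      ((LinearMap.lTensor V (Coalgebra.comul (R := k) (A := H))) (ρ v)))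

/-- `lam : V → H ⊗ V` is a left `H`-comodule structure. -/
def IsLeftCoaction (lam : V →ₗ[k] H ⊗[k] V) : Prop :=
  (∀ v, (TensorProduct.lid k V)
      ((LinearMap.rTensor V (Coalgebra.counit (R := k) (A := H))) (lam v)) = v) ∧
  (∀ v, (LinearMap.lTensor H lam) (lam v) =
    (TensorProduct.assoc k H H V)
      ((LinearMap.rTensor V (Coalgebra.comul (R := k) (A := H))) (lam v)))

/-- `act : V ⊗ A → V` is a right `A`-module structure on the `k`-vector space `V`. -/
def IsRightAction (act : V ⊗[k] A →ₗ[k] V) : Prop :=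
  (∀ v, act (v ⊗ₜ (1 : A)) = v) ∧
  (∀ (v : V) (a b : A), act (v ⊗ₜ (a * b)) = act (act (v ⊗ₜ a) ⊗ₜ b))

/-- `act : A ⊗ V → V` is a left `A`-module structure on the `k`-vector space `V`. -/
def IsLeftAction (act : A ⊗[k] V →ₗ[k] V) : Prop :=
  (∀ v, act ((1 : A) ⊗ₜ v) = v) ∧
  (∀ (a b : A) (v : V), act ((a * b) ⊗ₜ v) = act (a ⊗ₜ act (b ⊗ₜ v)))

end Props

variable {k : Type} [Field k]
variable {P : Type} [Ring P] [HopfAlgebra k P]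
variable {H : Type} [Ring H] [HopfAlgebra k H]

/-- The quantum homogeneous space `B = Pᴴ = {p : p₁ ⊗ π(p₂) = p ⊗ 1}`,
as a `k`-subspace of `P`. -/
def qhs (π : P →ₐc[k] H) : Submodule k P :=
  LinearMap.ker ((LinearMap.lTensor P (π : P →ₗ[k] H)) ∘ₗ
    (Coalgebra.comul (R := k) (A := P)) - (TensorProduct.mk k P H).flip 1)

lemma mem_qhs (π : P →ₐc[k] H) (p : P) :
    p ∈ qhs π ↔ (LinearMap.lTensor P (π : P →ₗ[k] H))
      (Coalgebra.comul (R := k) (A := P) p) = p ⊗ₜ (1 : H) := by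
  simp [qhs, sub_eq_zero, LinearMap.mem_ker]

lemma lTensor_pi_eq (π : P →ₐc[k] H) :
    (LinearMap.lTensor P (π : P →ₗ[k] H)) =
      (Algebra.TensorProduct.map (AlgHom.id k P) (π : P →ₐ[k] H)).toLinearMap :=
  TensorProduct.ext' fun p q => by
    simp [Algebra.TensorProduct.map_tmul]

/-- The quantum homogeneous space `B = Pᴴ` as a subalgebra of `P`. -/
def qhsAlg (π : P →ₐc[k] H) : Subalgebra k P where
  carrier := qhs π
  add_mem' ha hb := (qhs π).add_mem ha hb
  zero_mem' := (qhs π).zero_mem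
  one_mem' := by
    rw [SetLike.mem_coe, mem_qhs, Bialgebra.comul_one, Algebra.TensorProduct.one_def]
    simp
  mul_mem' := by
    intro a b ha hb
    rw [SetLike.mem_coe, mem_qhs] at ha hb ⊢
    rw [lTensor_pi_eq] at ha hb ⊢
    simp only [AlgHom.toLinearMap_apply] at ha hb ⊢
    have hc := map_mul (Bialgebra.comulAlgHom k P) a b
    simp only [Bialgebra.comulAlgHom_apply] at hc
    rw [hc, map_mul, ha, hb, Algebra.TensorProduct.tmul_mul_tmul, one_mul]
  algebraMap_mem' := by
    intro r
    rw [Algebra.algebraMap_eq_smul_one]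
    exact (qhs π).smul_mem r (by
      rw [mem_qhs, Bialgebra.comul_one, Algebra.TensorProduct.one_def]
      simp)

/-- The inclusion `B → P` as a `k`-linear map. -/
def qhsIncl (π : P →ₐc[k] H) : (qhsAlg π) →ₗ[k] P := (qhsAlg π).val.toLinearMap

/-- `coactB : B → P ⊗ B` is the restriction of the comultiplication of `P`
(such a map exists and is unique since `Δ(B) ⊆ P ⊗ B`). -/
def IsRestrictedComul (π : P →ₐc[k] H)
    (coactB : (qhsAlg π) →ₗ[k] P ⊗[k] (qhsAlg π)) : Prop :=
  (LinearMap.lTensor P (qhsIncl π)) ∘ₗ coactB =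
    (Coalgebra.comul (R := k) (A := P)) ∘ₗ (qhsIncl π)

/-- The right `H`-coaction `p ↦ p₁ ⊗ π(p₂)` on `P`. -/
def piCoact (π : P →ₐc[k] H) : P →ₗ[k] P ⊗[k] H :=
  (LinearMap.lTensor P (π : P →ₗ[k] H)) ∘ₗ (Coalgebra.comul (R := k) (A := P))

/-- The map `a ↦ a₂ ⊗ π(S(a₁))` on `P`. -/
def adCoact₀ (π : P →ₐc[k] H) : P →ₗ[k] P ⊗[k] H :=
  (LinearMap.lTensor P ((π : P →ₗ[k] H) ∘ₗ (HopfAlgebra.antipode (R := k) (A := P)))) ∘ₗ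
    (TensorProduct.comm k P P).toLinearMap ∘ₗ
    (Coalgebra.comul (R := k) (A := P))

/-- The crossed `(H,B)`-module condition
`x₍₀₎ ◁ b ⊗ x₍₁₎ = (x ◁ b₂)₍₀₎ ⊗ π(b₁)(x ◁ b₂)₍₁₎` for a right `B`-module and
right `H`-comodule `X`, where `Δ(b) = b₁ ⊗ b₂ ∈ P ⊗ B` is given by `coactB`. -/
def IsCrossedPair (π : P →ₐc[k] H)
    (coactB : (qhsAlg π) →ₗ[k] P ⊗[k] (qhsAlg π))
    {X : Type} [AddCommGroup X] [Module k X]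
    (ract : X ⊗[k] (qhsAlg π) →ₗ[k] X) (ρ : X →ₗ[k] X ⊗[k] H) : Prop :=
  (LinearMap.rTensor H ract) ∘ₗ
      (TensorProduct.assoc k X (qhsAlg π) H).symm.toLinearMap ∘ₗ
      (LinearMap.lTensor X (TensorProduct.comm k H (qhsAlg π)).toLinearMap) ∘ₗ
      (TensorProduct.assoc k X H (qhsAlg π)).toLinearMap ∘ₗ
      (LinearMap.rTensor (qhsAlg π) ρ) =
  (LinearMap.lTensor X (LinearMap.mul' k H)) ∘ₗ
      (TensorProduct.leftComm k H X H).toLinearMap ∘ₗ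
      (TensorProduct.map (π : P →ₗ[k] H) (ρ ∘ₗ ract)) ∘ₗ
      (TensorProduct.leftComm k X P (qhsAlg π)).toLinearMap ∘ₗ
      (LinearMap.lTensor X coactB)

/-- A left `P`-module, left `P`-comodule, right `H`-comodule, right `B`-module
with all structures pairwise compatible, on a fixed `k`-vector space `Y`.
Here `coactB` is the restricted comultiplication `B → P ⊗ B`. -/
structure PPHBStr (π : P →ₐc[k] H)
    (coactB : (qhsAlg π) →ₗ[k] P ⊗[k] (qhsAlg π))
    (Y : Type) [AddCommGroup Y] [Module k Y] where
  lact : P ⊗[k] Y →ₗ[k] Y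
  ract : Y ⊗[k] (qhsAlg π) →ₗ[k] Y
  lam : Y →ₗ[k] P ⊗[k] Y
  ρ : Y →ₗ[k] Y ⊗[k] H
  lact_action : IsLeftAction lact
  ract_action : IsRightAction ract
  lam_coaction : IsLeftCoaction lam
  ρ_coaction : IsRightCoaction ρ
  acts_comm : ∀ (p : P) (y : Y) (b : qhsAlg π),
    ract (lact (p ⊗ₜ y) ⊗ₜ b) = lact (p ⊗ₜ ract (y ⊗ₜ b))
  coacts_comm : ∀ y, (LinearMap.rTensor H lam) (ρ y) =
    (TensorProduct.assoc k P Y H).symm ((LinearMap.lTensor P ρ) (lam y))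
  /-- `λ(p ▷ y) = p₁ y₍₋₁₎ ⊗ p₂ ▷ y₍₀₎` -/
  lact_lam : lam ∘ₗ lact =
    (TensorProduct.map (LinearMap.mul' k P) lact) ∘ₗ
      (tensorTensorTensorComm k P P P Y).toLinearMap ∘ₗ
      (TensorProduct.map (Coalgebra.comul (R := k) (A := P)) lam)
  /-- `ρ(p ▷ y) = p₁ ▷ y₍₀₎ ⊗ π(p₂) y₍₁₎` -/
  lact_ρ : ρ ∘ₗ lact =
    (TensorProduct.map lact (LinearMap.mul' k H)) ∘ₗ
      (tensorTensorTensorComm k P H Y H).toLinearMap ∘ₗ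
      (TensorProduct.map (piCoact π) ρ)
  /-- `λ(y ◁ b) = y₍₋₁₎ b₁ ⊗ y₍₀₎ ◁ b₂` -/
  ract_lam : lam ∘ₗ ract =
    (TensorProduct.map (LinearMap.mul' k P) ract) ∘ₗ
      (tensorTensorTensorComm k P Y P (qhsAlg π)).toLinearMap ∘ₗ
      (TensorProduct.map lam coactB)
  /-- `ρ(y ◁ b) = y₍₀₎ ◁ b ⊗ y₍₁₎` (`B` carries the trivial `H`-coaction) -/
  ract_ρ : ρ ∘ₗ ract =
    (LinearMap.rTensor H ract) ∘ₗ
      (TensorProduct.assoc k Y (qhsAlg π) H).symm.toLinearMap ∘ₗ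
      (LinearMap.lTensor Y (TensorProduct.comm k H (qhsAlg π)).toLinearMap) ∘ₗ
      (TensorProduct.assoc k Y H (qhsAlg π)).toLinearMap ∘ₗ
      (LinearMap.rTensor (qhsAlg π) ρ)

section TensorComodule
variable {V W : Type} [AddCommGroup V] [Module k V] [AddCommGroup W] [Module k W]

/-- `(v ⊗ h) ⊗ (w ⊗ g) ↦ (v ⊗ w) ⊗ h g`, which turns a pair of coactions into the
diagonal coaction on `V ⊗ W`. -/
def mulCoactions (A V W : Type) [Ring A] [Algebra k A] [AddCommGroup V] [Module k V]
    [AddCommGroup W] [Module k W] :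
    (V ⊗[k] A) ⊗[k] (W ⊗[k] A) →ₗ[k] (V ⊗[k] W) ⊗[k] A :=
  (LinearMap.lTensor (V ⊗[k] W) (LinearMap.mul' k A)) ∘ₗ
    (tensorTensorTensorComm k V A W A).toLinearMap

@[simp]
lemma mulCoactions_tmul {A : Type} [Ring A] [Algebra k A] (v : V) (w : W) (g h : A) :
    mulCoactions A V W ((v ⊗ₜ[k] g) ⊗ₜ (w ⊗ₜ h)) = (v ⊗ₜ w) ⊗ₜ (g * h) := by
  simp [mulCoactions]

lemma IsRightCoaction.tensor {ρ : V →ₗ[k] V ⊗[k] H} {σ : W →ₗ[k] W ⊗[k] H}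
    (hρ : IsRightCoaction ρ) (hσ : IsRightCoaction σ) :
    IsRightCoaction (mulCoactions H V W ∘ₗ TensorProduct.map ρ σ) := by
  constructor
  · have key : ∀ (s : V ⊗[k] H) (t : W ⊗[k] H),
        TensorProduct.rid k (V ⊗[k] W)
          (LinearMap.lTensor (V ⊗[k] W) Coalgebra.counit (mulCoactions H V W (s ⊗ₜ t))) =
        TensorProduct.rid k V (LinearMap.lTensor V Coalgebra.counit s) ⊗ₜ
          TensorProduct.rid k W (LinearMap.lTensor W Coalgebra.counit t) := by
      intro s t
      induction s using TensorProduct.induction_on with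
      | zero => simp
      | add s s' hs hs' => simp only [add_tmul, map_add, hs, hs']
      | tmul v g =>
        induction t using TensorProduct.induction_on with
        | zero => simp
        | add t t' ht ht' => simp only [tmul_add, map_add, ht, ht']
        | tmul w h => simp [smul_tmul', tmul_smul, smul_smul, mul_comm]
    intro y
    induction y using TensorProduct.induction_on with
    | zero => simp
    | add y y' hy hy' => simp only [map_add, hy, hy']
    | tmul v w => simp only [LinearMap.comp_apply, map_tmul, key, hρ.1, hσ.1]
  · have comul_key : ∀ (s : V ⊗[k] H) (t : W ⊗[k] H),
        LinearMap.lTensor (V ⊗[k] W) Coalgebra.comul (mulCoactions H V W (s ⊗ₜ t)) =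
        mulCoactions (H ⊗[k] H) V W
          (LinearMap.lTensor V Coalgebra.comul s ⊗ₜ LinearMap.lTensor W Coalgebra.comul t) := by
      intro s t
      induction s using TensorProduct.induction_on with
      | zero => simp
      | add s s' hs hs' => simp only [add_tmul, map_add, hs, hs']
      | tmul v g =>
        induction t using TensorProduct.induction_on with
        | zero => simp
        | add t t' ht ht' => simp only [tmul_add, map_add, ht, ht']
        | tmul w h => simp
    have coact_key : ∀ (s : V ⊗[k] H) (t : W ⊗[k] H),
        LinearMap.rTensor H (mulCoactions H V W ∘ₗ TensorProduct.map ρ σ)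
          (mulCoactions H V W (s ⊗ₜ t)) =
        LinearMap.rTensor H (mulCoactions H V W)
          (mulCoactions H (V ⊗[k] H) (W ⊗[k] H)
            (LinearMap.rTensor H ρ s ⊗ₜ LinearMap.rTensor H σ t)) := by
      intro s t
      induction s using TensorProduct.induction_on with
      | zero => simp
      | add s s' hs hs' => simp only [add_tmul, map_add, hs, hs']
      | tmul v g =>
        induction t using TensorProduct.induction_on with
        | zero => simp
        | add t t' ht ht' => simp only [tmul_add, map_add, ht, ht']
        | tmul w h => simp
    have assoc_key : LinearMap.rTensor H (mulCoactions H V W) ∘ₗ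
          mulCoactions H (V ⊗[k] H) (W ⊗[k] H) ∘ₗ
            TensorProduct.map (TensorProduct.assoc k V H H).symm.toLinearMap
              (TensorProduct.assoc k W H H).symm.toLinearMap =
        (TensorProduct.assoc k (V ⊗[k] W) H H).symm.toLinearMap ∘ₗ
          mulCoactions (H ⊗[k] H) V W := by
      ext; simp
    intro y
    induction y using TensorProduct.induction_on with
    | zero => simp
    | add y y' hy hy' => simp only [map_add, hy, hy']
    | tmul v w =>
      have h := LinearMap.congr_fun assoc_key
        (LinearMap.lTensor V Coalgebra.comul (ρ v) ⊗ₜ LinearMap.lTensor W Coalgebra.comul (σ w))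
      simp only [LinearMap.comp_apply, map_tmul, LinearEquiv.coe_coe] at h
      rw [LinearMap.comp_apply, map_tmul, coact_key, comul_key, hρ.2, hσ.2, h]

end TensorComodule

lemma piCoact_mul (π : P →ₐc[k] H) (p q : P) :
    piCoact π (p * q) = piCoact π p * piCoact π q := by
  simp only [piCoact, LinearMap.comp_apply, lTensor_pi_eq, Bialgebra.comul_mul,
    AlgHom.toLinearMap_apply, map_mul]

/-- `(p₁ ⊗ p₂) ⊗ π(p₃) = p₁ ⊗ (p₂ ⊗ π(p₃))` up to the associator. -/
lemma rTensor_comul_piCoact (π : P →ₐc[k] H) (p : P) :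
    LinearMap.rTensor H Coalgebra.comul (piCoact π p) =
      (TensorProduct.assoc k P P H).symm
        (LinearMap.lTensor P (piCoact π) (Coalgebra.comul (R := k) p)) := by
  have h := congrArg (LinearMap.lTensor P (LinearMap.lTensor P (π : P →ₗ[k] H)))
    (Coalgebra.coassoc_apply (R := k) p)
  rw [LinearEquiv.eq_symm_apply]
  simp only [piCoact, LinearMap.lTensor_comp, LinearMap.comp_apply]
  rw [← h]
  generalize Coalgebra.comul (R := k) p = s
  have : (TensorProduct.assoc k P P H).toLinearMap ∘ₗ
        LinearMap.rTensor H Coalgebra.comul ∘ₗ LinearMap.lTensor P (π : P →ₗ[k] H) =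
      LinearMap.lTensor P (LinearMap.lTensor P (π : P →ₗ[k] H)) ∘ₗ
        (TensorProduct.assoc k P P P).toLinearMap ∘ₗ LinearMap.rTensor P Coalgebra.comul := by
    ext a b
    simp only [AlgebraTensorModule.curry_apply, LinearMap.restrictScalars_self, curry_apply,
      LinearMap.comp_apply, LinearMap.lTensor_tmul, LinearMap.rTensor_tmul, LinearEquiv.coe_coe]
    generalize Coalgebra.comul (R := k) a = t
    induction t using TensorProduct.induction_on with
    | zero => simp
    | add t t' ht ht' => simp only [add_tmul, map_add, ht, ht']
    | tmul c d => simp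
  exact LinearMap.congr_fun this s

lemma isRightCoaction_piCoact (π : P →ₐc[k] H) : IsRightCoaction (piCoact π) := by
  have hcounit : (Coalgebra.counit (R := k) (A := H)) ∘ₗ (π : P →ₗ[k] H) = Coalgebra.counit :=
    CoalgHomClass.counit_comp π
  have hcomul : (Coalgebra.comul (R := k) (A := H)) ∘ₗ (π : P →ₗ[k] H) =
      TensorProduct.map (π : P →ₗ[k] H) (π : P →ₗ[k] H) ∘ₗ Coalgebra.comul :=
    (CoalgHomClass.map_comp_comul π).symm
  constructor
  · intro p
    rw [piCoact, LinearMap.comp_apply, ← LinearMap.lTensor_comp_apply, hcounit,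
      Coalgebra.lTensor_counit_comul]
    simp
  · intro p
    have hsplit : LinearMap.rTensor H (piCoact π) (piCoact π p) =
        LinearMap.rTensor H (LinearMap.lTensor P (π : P →ₗ[k] H))
          (LinearMap.rTensor H Coalgebra.comul (piCoact π p)) := by
      rw [← LinearMap.rTensor_comp_apply]; rfl
    rw [hsplit, rTensor_comul_piCoact, LinearEquiv.eq_symm_apply]
    rw [piCoact, LinearMap.comp_apply, ← LinearMap.lTensor_comp_apply, hcomul]
    generalize Coalgebra.comul (R := k) p = s
    have : (TensorProduct.assoc k P H H).toLinearMap ∘ₗ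
          LinearMap.rTensor H (LinearMap.lTensor P (π : P →ₗ[k] H)) ∘ₗ
          (TensorProduct.assoc k P P H).symm.toLinearMap ∘ₗ
          LinearMap.lTensor P (LinearMap.lTensor P (π : P →ₗ[k] H)) =
        LinearMap.lTensor P (TensorProduct.map (π : P →ₗ[k] H) (π : P →ₗ[k] H)) := by
      ext; simp
    rw [LinearMap.lTensor_comp, LinearMap.lTensor_comp, LinearMap.comp_apply,
      LinearMap.comp_apply, ← this]
    rfl

section Restriction
variable {π : P →ₐc[k] H} {coactB : (qhsAlg π) →ₗ[k] P ⊗[k] (qhsAlg π)}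

lemma lTensor_qhsIncl_injective (π : P →ₐc[k] H) (V : Type) [AddCommGroup V] [Module k V] :
    Function.Injective (LinearMap.lTensor V (qhsIncl π)) :=
  Module.Flat.lTensor_preserves_injective_linearMap _ Subtype.val_injective

lemma IsRestrictedComul.apply (hco : IsRestrictedComul π coactB) (b : qhsAlg π) :
    LinearMap.lTensor P (qhsIncl π) (coactB b) = Coalgebra.comul (R := k) (b : P) :=
  LinearMap.congr_fun hco b

lemma lTensor_qhsIncl_mul (π : P →ₐc[k] H) (s t : P ⊗[k] (qhsAlg π)) :
    LinearMap.lTensor P (qhsIncl π) (s * t) =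
      LinearMap.lTensor P (qhsIncl π) s * LinearMap.lTensor P (qhsIncl π) t :=
  map_mul (Algebra.TensorProduct.map (AlgHom.id k P) (qhsAlg π).val) s t

lemma IsRestrictedComul.map_one (hco : IsRestrictedComul π coactB) :
    coactB 1 = 1 ⊗ₜ 1 := by
  apply lTensor_qhsIncl_injective π P
  rw [hco.apply]
  simp [qhsIncl, Algebra.TensorProduct.one_def]

lemma IsRestrictedComul.map_mul (hco : IsRestrictedComul π coactB) (a b : qhsAlg π) :
    coactB (a * b) = coactB a * coactB b := by
  apply lTensor_qhsIncl_injective π P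
  rw [lTensor_qhsIncl_mul, hco.apply, hco.apply, hco.apply]
  simp

lemma IsRestrictedComul.coassoc (hco : IsRestrictedComul π coactB) (b : qhsAlg π) :
    LinearMap.lTensor P coactB (coactB b) =
      TensorProduct.assoc k P P (qhsAlg π)
        (LinearMap.rTensor (qhsAlg π) Coalgebra.comul (coactB b)) := by
  apply Module.Flat.lTensor_preserves_injective_linearMap (M := P) _
    (lTensor_qhsIncl_injective π P)
  have hnat : LinearMap.lTensor P (LinearMap.lTensor P (qhsIncl π)) ∘ₗ
        (TensorProduct.assoc k P P (qhsAlg π)).toLinearMap =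
      (TensorProduct.assoc k P P P).toLinearMap ∘ₗ LinearMap.lTensor (P ⊗[k] P) (qhsIncl π) := by
    ext; simp
  have h := LinearMap.congr_fun hnat (LinearMap.rTensor (qhsAlg π) Coalgebra.comul (coactB b))
  simp only [LinearMap.comp_apply, LinearEquiv.coe_coe] at h
  rw [h, ← LinearMap.lTensor_comp_apply, hco, LinearMap.lTensor_comp_apply, hco.apply,
    ← Coalgebra.coassoc_apply, ← hco.apply]
  exact congrArg (TensorProduct.assoc k P P P)
    (LinearMap.congr_fun (LinearMap.rTensor_comp_lTensor (f := Coalgebra.comul)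
      (g := qhsIncl π)) (coactB b) |>.trans
      (LinearMap.congr_fun (LinearMap.lTensor_comp_rTensor (f := Coalgebra.comul)
      (g := qhsIncl π)) (coactB b)).symm)

end Restriction

section TensorModule
variable {B X : Type} [Ring B] [Algebra k B] [AddCommGroup X] [Module k X]

/-- The action of `P ⊗ B` on `P ⊗ X` on the right:
`((p ⊗ x) ⊗ (q ⊗ b)) ↦ p q ⊗ x ◁ b`. -/
def tensorAct (P : Type) [Ring P] [Algebra k P] (ract : X ⊗[k] B →ₗ[k] X) :
    (P ⊗[k] X) ⊗[k] (P ⊗[k] B) →ₗ[k] P ⊗[k] X :=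
  TensorProduct.map (LinearMap.mul' k P) ract ∘ₗ
    (tensorTensorTensorComm k P X P B).toLinearMap

@[simp]
lemma tensorAct_tmul (ract : X ⊗[k] B →ₗ[k] X) (p q : P) (x : X) (b : B) :
    tensorAct P ract ((p ⊗ₜ x) ⊗ₜ (q ⊗ₜ b)) = (p * q) ⊗ₜ ract (x ⊗ₜ b) := by
  simp [tensorAct]

lemma tensorAct_one {ract : X ⊗[k] B →ₗ[k] X} (h : IsRightAction ract) (y : P ⊗[k] X) :
    tensorAct P ract (y ⊗ₜ (1 ⊗ₜ 1)) = y := by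
  induction y using TensorProduct.induction_on with
  | zero => simp
  | add y y' hy hy' => simp only [add_tmul, map_add, hy, hy']
  | tmul p x => simp [h.1]

lemma tensorAct_mul {ract : X ⊗[k] B →ₗ[k] X} (h : IsRightAction ract) (y : P ⊗[k] X)
    (s t : P ⊗[k] B) :
    tensorAct P ract (y ⊗ₜ (s * t)) = tensorAct P ract (tensorAct P ract (y ⊗ₜ s) ⊗ₜ t) := by
  induction y using TensorProduct.induction_on with
  | zero => simp
  | add y y' hy hy' => simp only [add_tmul, map_add, hy, hy']
  | tmul p x =>
    induction s using TensorProduct.induction_on with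
    | zero => simp
    | add s s' hs hs' => simp only [add_mul, add_tmul, tmul_add, map_add, hs, hs']
    | tmul q a =>
      induction t using TensorProduct.induction_on with
      | zero => simp
      | add t t' ht ht' => simp only [mul_add, tmul_add, map_add, ht, ht']
      | tmul r b => simp [h.2, mul_assoc]

/-- The left regular action of `P` on `P ⊗ X`. -/
def regularAct (k P X : Type) [Field k] [Ring P] [Algebra k P] [AddCommGroup X] [Module k X] :
    P ⊗[k] (P ⊗[k] X) →ₗ[k] P ⊗[k] X :=
  LinearMap.rTensor X (LinearMap.mul' k P) ∘ₗ (TensorProduct.assoc k P P X).symm.toLinearMap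

@[simp]
lemma regularAct_tmul (p q : P) (x : X) :
    regularAct k P X (p ⊗ₜ (q ⊗ₜ x)) = (p * q) ⊗ₜ x := by
  simp [regularAct]

lemma isLeftAction_regularAct : IsLeftAction (regularAct k P X) := by
  constructor
  · intro y
    induction y using TensorProduct.induction_on with
    | zero => simp
    | add y y' hy hy' => simp only [tmul_add, map_add, hy, hy']
    | tmul p x => simp
  · intro a b y
    induction y using TensorProduct.induction_on with
    | zero => simp
    | add y y' hy hy' => simp only [tmul_add, map_add, hy, hy']
    | tmul p x => simp [mul_assoc]

lemma tensorAct_regularAct (ract : X ⊗[k] B →ₗ[k] X) (p : P) (y : P ⊗[k] X) (s : P ⊗[k] B) :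
    tensorAct P ract (regularAct k P X (p ⊗ₜ y) ⊗ₜ s) =
      regularAct k P X (p ⊗ₜ tensorAct P ract (y ⊗ₜ s)) := by
  induction y using TensorProduct.induction_on with
  | zero => simp
  | add y y' hy hy' => simp only [add_tmul, tmul_add, map_add, hy, hy']
  | tmul q x =>
    induction s using TensorProduct.induction_on with
    | zero => simp
    | add s s' hs hs' => simp only [tmul_add, map_add, hs, hs']
    | tmul r b => simp [mul_assoc]

/-- The left regular coaction of `P` on `P ⊗ X`. -/
def regularCoact (k P X : Type) [Field k] [Ring P] [HopfAlgebra k P] [AddCommGroup X]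
    [Module k X] : P ⊗[k] X →ₗ[k] P ⊗[k] (P ⊗[k] X) :=
  (TensorProduct.assoc k P P X).toLinearMap ∘ₗ LinearMap.rTensor X Coalgebra.comul

@[simp]
lemma regularCoact_tmul (p : P) (x : X) :
    regularCoact k P X (p ⊗ₜ x) =
      TensorProduct.assoc k P P X (Coalgebra.comul (R := k) p ⊗ₜ x) := by
  simp [regularCoact]

lemma isLeftCoaction_regularCoact : IsLeftCoaction (regularCoact k P X) := by
  constructor
  · intro y
    induction y using TensorProduct.induction_on with
    | zero => simp
    | add y y' hy hy' => simp only [map_add, hy, hy']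
    | tmul p x =>
      have key : ∀ s : P ⊗[k] P, LinearMap.rTensor (P ⊗[k] X) Coalgebra.counit
          (TensorProduct.assoc k P P X (s ⊗ₜ x)) =
          TensorProduct.assoc k k P X
            (LinearMap.rTensor P Coalgebra.counit s ⊗ₜ x) := by
        intro s
        induction s using TensorProduct.induction_on with
        | zero => simp
        | add s s' hs hs' => simp only [add_tmul, map_add, hs, hs']
        | tmul a b => simp
      rw [regularCoact_tmul, key, Coalgebra.rTensor_counit_comul]
      simp
  · intro y
    induction y using TensorProduct.induction_on with
    | zero => simp
    | add y y' hy hy' => simp only [map_add, hy, hy']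
    | tmul p x =>
      have coact_key : ∀ s : P ⊗[k] P, LinearMap.lTensor P (regularCoact k P X)
          (TensorProduct.assoc k P P X (s ⊗ₜ x)) =
          LinearMap.lTensor P (TensorProduct.assoc k P P X).toLinearMap
            (TensorProduct.assoc k P (P ⊗[k] P) X
              (LinearMap.lTensor P Coalgebra.comul s ⊗ₜ x)) := by
        intro s
        induction s using TensorProduct.induction_on with
        | zero => simp
        | add s s' hs hs' => simp only [add_tmul, map_add, hs, hs']
        | tmul a b => simp
      have comul_key : ∀ s : P ⊗[k] P, LinearMap.rTensor (P ⊗[k] X) Coalgebra.comul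
          (TensorProduct.assoc k P P X (s ⊗ₜ x)) =
          TensorProduct.assoc k (P ⊗[k] P) P X
            (LinearMap.rTensor P Coalgebra.comul s ⊗ₜ x) := by
        intro s
        induction s using TensorProduct.induction_on with
        | zero => simp
        | add s s' hs hs' => simp only [add_tmul, map_add, hs, hs']
        | tmul a b => simp
      rw [regularCoact_tmul, coact_key, comul_key, ← Coalgebra.coassoc_apply]
      generalize LinearMap.rTensor P Coalgebra.comul (Coalgebra.comul (R := k) p) = s
      have pentagon : LinearMap.lTensor P (TensorProduct.assoc k P P X).toLinearMap ∘ₗ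
            (TensorProduct.assoc k P (P ⊗[k] P) X).toLinearMap ∘ₗ
            LinearMap.rTensor X (TensorProduct.assoc k P P P).toLinearMap =
          (TensorProduct.assoc k P P (P ⊗[k] X)).toLinearMap ∘ₗ
            (TensorProduct.assoc k (P ⊗[k] P) P X).toLinearMap := by
        ext; simp
      exact LinearMap.congr_fun pentagon (s ⊗ₜ x)

lemma regularCoact_regularAct :
    regularCoact k P X ∘ₗ regularAct k P X =
      TensorProduct.map (LinearMap.mul' k P) (regularAct k P X) ∘ₗ
        (tensorTensorTensorComm k P P P (P ⊗[k] X)).toLinearMap ∘ₗ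
        TensorProduct.map Coalgebra.comul (regularCoact k P X) := by
  ext p q x
  simp only [AlgebraTensorModule.curry_apply, LinearMap.restrictScalars_self, curry_apply,
    LinearMap.comp_apply, map_tmul, LinearEquiv.coe_coe, regularAct_tmul, regularCoact_tmul,
    Bialgebra.comul_mul]
  generalize Coalgebra.comul (R := k) p = s
  generalize Coalgebra.comul (R := k) q = t
  induction s using TensorProduct.induction_on with
  | zero => simp
  | add s s' hs hs' => simp only [add_mul, add_tmul, map_add, hs, hs']
  | tmul a b =>
    induction t using TensorProduct.induction_on with
    | zero => simp
    | add t t' ht ht' => simp only [mul_add, add_tmul, tmul_add, map_add, ht, ht']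
    | tmul c d => simp

/-- The tensor product `p ⊗ x ↦ p₁ ⊗ x₍₀₎ ⊗ π(p₂) x₍₁₎` of the coaction of `H` on `P`
with `ρ`. -/
def tensorCoact (π : P →ₐc[k] H) (ρ : X →ₗ[k] X ⊗[k] H) :
    P ⊗[k] X →ₗ[k] (P ⊗[k] X) ⊗[k] H :=
  mulCoactions H P X ∘ₗ TensorProduct.map (piCoact π) ρ

@[simp]
lemma tensorCoact_tmul (π : P →ₐc[k] H) (ρ : X →ₗ[k] X ⊗[k] H) (p : P) (x : X) :
    tensorCoact π ρ (p ⊗ₜ x) = mulCoactions H P X (piCoact π p ⊗ₜ ρ x) := rfl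

lemma regularCoact_tensorCoact (π : P →ₐc[k] H) (ρ : X →ₗ[k] X ⊗[k] H) (y : P ⊗[k] X) :
    LinearMap.rTensor H (regularCoact k P X) (tensorCoact π ρ y) =
      (TensorProduct.assoc k P (P ⊗[k] X) H).symm
        (LinearMap.lTensor P (tensorCoact π ρ) (regularCoact k P X y)) := by
  induction y using TensorProduct.induction_on with
  | zero => simp
  | add y y' hy hy' => simp only [map_add, hy, hy']
  | tmul p x =>
    rw [tensorCoact_tmul, regularCoact_tmul]
    have hleft : ∀ (s : P ⊗[k] H) (t : X ⊗[k] H),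
        LinearMap.rTensor H (regularCoact k P X) (mulCoactions H P X (s ⊗ₜ t)) =
        LinearMap.rTensor H (TensorProduct.assoc k P P X).toLinearMap
          (mulCoactions H (P ⊗[k] P) X (LinearMap.rTensor H Coalgebra.comul s ⊗ₜ t)) := by
      intro s t
      induction s using TensorProduct.induction_on with
      | zero => simp
      | add s s' hs hs' => simp only [add_tmul, map_add, hs, hs']
      | tmul a h =>
        induction t using TensorProduct.induction_on with
        | zero => simp
        | add t t' ht ht' => simp only [tmul_add, map_add, ht, ht']
        | tmul z g => simp
    have hright : ∀ (a : P) (s : P ⊗[k] H) (t : X ⊗[k] H),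
        LinearMap.rTensor H (TensorProduct.assoc k P P X).toLinearMap
          (mulCoactions H (P ⊗[k] P) X ((TensorProduct.assoc k P P H).symm (a ⊗ₜ s) ⊗ₜ t)) =
        (TensorProduct.assoc k P (P ⊗[k] X) H).symm (a ⊗ₜ mulCoactions H P X (s ⊗ₜ t)) := by
      intro a s t
      induction s using TensorProduct.induction_on with
      | zero => simp
      | add s s' hs hs' => simp only [tmul_add, add_tmul, map_add, hs, hs']
      | tmul b h =>
        induction t using TensorProduct.induction_on with
        | zero => simp
        | add t t' ht ht' => simp only [tmul_add, map_add, ht, ht']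
        | tmul z g => simp
    rw [hleft, rTensor_comul_piCoact]
    generalize Coalgebra.comul (R := k) p = s
    induction s using TensorProduct.induction_on with
    | zero => simp
    | add s s' hs hs' => simp only [add_tmul, map_add, hs, hs']
    | tmul a b =>
      rw [LinearMap.lTensor_tmul, hright, TensorProduct.assoc_tmul, LinearMap.lTensor_tmul,
        tensorCoact_tmul]

lemma tensorCoact_regularAct (π : P →ₐc[k] H) (ρ : X →ₗ[k] X ⊗[k] H) :
    tensorCoact π ρ ∘ₗ regularAct k P X =
      TensorProduct.map (regularAct k P X) (LinearMap.mul' k H) ∘ₗ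
        (tensorTensorTensorComm k P H (P ⊗[k] X) H).toLinearMap ∘ₗ
        TensorProduct.map (piCoact π) (tensorCoact π ρ) := by
  ext p q x
  simp only [AlgebraTensorModule.curry_apply, LinearMap.restrictScalars_self, curry_apply,
    LinearMap.comp_apply, map_tmul, LinearEquiv.coe_coe, regularAct_tmul, tensorCoact_tmul,
    piCoact_mul]
  generalize piCoact π p = r
  generalize piCoact π q = s
  generalize ρ x = t
  induction r using TensorProduct.induction_on with
  | zero => simp
  | add r r' hr hr' => simp only [add_mul, add_tmul, map_add, hr, hr']
  | tmul a f =>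
    induction s using TensorProduct.induction_on with
    | zero => simp
    | add s s' hs hs' => simp only [mul_add, add_tmul, tmul_add, map_add, hs, hs']
    | tmul b g =>
      induction t using TensorProduct.induction_on with
      | zero => simp
      | add t t' ht ht' => simp only [tmul_add, map_add, ht, ht']
      | tmul z h => simp [mul_assoc]

end TensorModule

section Crossed
variable {π : P →ₐc[k] H} {coactB : (qhsAlg π) →ₗ[k] P ⊗[k] (qhsAlg π)}
  {X : Type} [AddCommGroup X] [Module k X]

lemma isRightAction_tensorAct_coact (hco : IsRestrictedComul π coactB)
    {ract : X ⊗[k] (qhsAlg π) →ₗ[k] X} (h : IsRightAction ract) :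
    IsRightAction (tensorAct P ract ∘ₗ LinearMap.lTensor (P ⊗[k] X) coactB) := by
  constructor
  · intro y
    simp [hco.map_one, tensorAct_one h]
  · intro y a b
    simp [hco.map_mul, tensorAct_mul h]

lemma regularCoact_tensorAct (hco : IsRestrictedComul π coactB)
    (ract : X ⊗[k] (qhsAlg π) →ₗ[k] X) :
    regularCoact k P X ∘ₗ (tensorAct P ract ∘ₗ LinearMap.lTensor (P ⊗[k] X) coactB) =
      TensorProduct.map (LinearMap.mul' k P)
          (tensorAct P ract ∘ₗ LinearMap.lTensor (P ⊗[k] X) coactB) ∘ₗ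
        (tensorTensorTensorComm k P (P ⊗[k] X) P (qhsAlg π)).toLinearMap ∘ₗ
        TensorProduct.map (regularCoact k P X) coactB := by
  ext p x b
  simp only [AlgebraTensorModule.curry_apply, LinearMap.restrictScalars_self, curry_apply,
    LinearMap.comp_apply, map_tmul, LinearEquiv.coe_coe, LinearMap.lTensor_tmul,
    regularCoact_tmul]
  have hleft : ∀ u : P ⊗[k] (qhsAlg π),
      regularCoact k P X (tensorAct P ract ((p ⊗ₜ x) ⊗ₜ u)) =
      TensorProduct.map (LinearMap.mul' k P) (tensorAct P ract)
        (tensorTensorTensorComm k P (P ⊗[k] X) P (P ⊗[k] (qhsAlg π))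
          (TensorProduct.assoc k P P X (Coalgebra.comul (R := k) p ⊗ₜ x) ⊗ₜ
            TensorProduct.assoc k P P (qhsAlg π)
              (LinearMap.rTensor (qhsAlg π) Coalgebra.comul u))) := by
    intro u
    induction u using TensorProduct.induction_on with
    | zero => simp
    | add u u' hu hu' => simp only [tmul_add, map_add, hu, hu']
    | tmul q c =>
      rw [tensorAct_tmul, regularCoact_tmul, Bialgebra.comul_mul, LinearMap.rTensor_tmul]
      generalize Coalgebra.comul (R := k) p = s
      generalize Coalgebra.comul (R := k) q = t
      induction s using TensorProduct.induction_on with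
      | zero => simp
      | add s s' hs hs' => simp only [add_mul, add_tmul, map_add, hs, hs']
      | tmul a b =>
        induction t using TensorProduct.induction_on with
        | zero => simp
        | add t t' ht ht' => simp only [mul_add, add_tmul, tmul_add, map_add, ht, ht']
        | tmul c d => simp
  rw [hleft, ← hco.coassoc]
  generalize coactB b = u
  generalize Coalgebra.comul (R := k) p = s
  induction s using TensorProduct.induction_on with
  | zero => simp
  | add s s' hs hs' => simp only [add_tmul, map_add, hs, hs']
  | tmul a b =>
    induction u using TensorProduct.induction_on with
    | zero => simp
    | add u u' hu hu' => simp only [tmul_add, map_add, hu, hu']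
    | tmul c d => simp

/-- `q ⊗ (y ⊗ g) ↦ (a q ⊗ y) ⊗ h g`. -/
def mulLeftTensor (X : Type) [AddCommGroup X] [Module k X] (a : P) (h : H) :
    P ⊗[k] (X ⊗[k] H) →ₗ[k] (P ⊗[k] X) ⊗[k] H :=
  (TensorProduct.assoc k P X H).symm.toLinearMap ∘ₗ
    TensorProduct.map (LinearMap.mulLeft k a) (LinearMap.lTensor X (LinearMap.mulLeft k h))

@[simp]
lemma mulLeftTensor_tmul (a q : P) (h g : H) (y : X) :
    mulLeftTensor (k := k) X a h (q ⊗ₜ (y ⊗ₜ g)) = ((a * q) ⊗ₜ y) ⊗ₜ (h * g) := by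
  simp [mulLeftTensor]

lemma tensorCoact_tensorAct (hco : IsRestrictedComul π coactB)
    {ract : X ⊗[k] (qhsAlg π) →ₗ[k] X} {ρ : X →ₗ[k] X ⊗[k] H}
    (hX : IsCrossedPair π coactB ract ρ) :
    tensorCoact π ρ ∘ₗ (tensorAct P ract ∘ₗ LinearMap.lTensor (P ⊗[k] X) coactB) =
      LinearMap.rTensor H (tensorAct P ract ∘ₗ LinearMap.lTensor (P ⊗[k] X) coactB) ∘ₗ
        (TensorProduct.assoc k (P ⊗[k] X) (qhsAlg π) H).symm.toLinearMap ∘ₗ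
        LinearMap.lTensor (P ⊗[k] X) (TensorProduct.comm k H (qhsAlg π)).toLinearMap ∘ₗ
        (TensorProduct.assoc k (P ⊗[k] X) H (qhsAlg π)).toLinearMap ∘ₗ
        LinearMap.rTensor (qhsAlg π) (tensorCoact π ρ) := by
  ext p x b
  simp only [AlgebraTensorModule.curry_apply, LinearMap.restrictScalars_self, curry_apply,
    LinearMap.comp_apply, LinearEquiv.coe_coe, LinearMap.lTensor_tmul, LinearMap.rTensor_tmul,
    tensorCoact_tmul]
  let crossL (t : X ⊗[k] H) : (qhsAlg π) →ₗ[k] X ⊗[k] H :=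
    LinearMap.rTensor H ract ∘ₗ (TensorProduct.assoc k X (qhsAlg π) H).symm.toLinearMap ∘ₗ
      LinearMap.lTensor X (TensorProduct.comm k H (qhsAlg π)).toLinearMap ∘ₗ
      (TensorProduct.assoc k X H (qhsAlg π)).toLinearMap ∘ₗ
      TensorProduct.mk k (X ⊗[k] H) (qhsAlg π) t
  let crossR : P ⊗[k] (qhsAlg π) →ₗ[k] X ⊗[k] H :=
    LinearMap.lTensor X (LinearMap.mul' k H) ∘ₗ
      (TensorProduct.leftComm k H X H).toLinearMap ∘ₗ
      TensorProduct.map (π : P →ₗ[k] H) (ρ ∘ₗ ract) ∘ₗ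
      (TensorProduct.leftComm k X P (qhsAlg π)).toLinearMap ∘ₗ
      TensorProduct.mk k X (P ⊗[k] (qhsAlg π)) x
  have hcross : crossR ∘ₗ coactB = crossL (ρ x) :=
    LinearMap.ext fun c => (LinearMap.congr_fun hX (x ⊗ₜ c)).symm
  have hcoact : ∀ u : P ⊗[k] (qhsAlg π),
      tensorCoact π ρ (tensorAct P ract ((p ⊗ₜ x) ⊗ₜ u)) =
      mulCoactions H P X (TensorProduct.map (LinearMap.mulLeft k (piCoact π p) ∘ₗ piCoact π)
        (ρ ∘ₗ ract ∘ₗ TensorProduct.mk k X (qhsAlg π) x) u) := by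
    intro u
    induction u using TensorProduct.induction_on with
    | zero => simp
    | add u u' hu hu' => simp only [tmul_add, map_add, hu, hu']
    | tmul q c => simp [piCoact_mul]
  have hleft : ∀ (a : P) (h : H) (u : P ⊗[k] (qhsAlg π)),
      mulCoactions H P X (TensorProduct.map (LinearMap.mulLeft k (a ⊗ₜ h) ∘ₗ piCoact π)
        (ρ ∘ₗ ract ∘ₗ TensorProduct.mk k X (qhsAlg π) x) u) =
      mulLeftTensor X a h (LinearMap.lTensor P crossR
        (TensorProduct.assoc k P P (qhsAlg π)
          (LinearMap.rTensor (qhsAlg π) Coalgebra.comul u))) := by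
    intro a h u
    induction u using TensorProduct.induction_on with
    | zero => simp
    | add u u' hu hu' => simp only [map_add, hu, hu']
    | tmul q c =>
      simp only [map_tmul, LinearMap.comp_apply, piCoact, LinearMap.rTensor_tmul]
      generalize Coalgebra.comul (R := k) q = s
      induction s using TensorProduct.induction_on with
      | zero => simp
      | add s s' hs hs' => simp only [add_tmul, map_add, hs, hs']
      | tmul d e =>
        simp only [crossR, LinearMap.lTensor_tmul, TensorProduct.assoc_tmul,
          LinearMap.comp_apply, TensorProduct.mk_apply, LinearEquiv.coe_coe,
          TensorProduct.leftComm_tmul, map_tmul]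
        generalize ρ (ract (x ⊗ₜ c)) = t
        induction t using TensorProduct.induction_on with
        | zero => simp
        | add t t' ht ht' => simp only [tmul_add, map_add, ht, ht']
        | tmul y g => simp [mul_assoc]
  have hright : ∀ (a : P) (h : H) (t : X ⊗[k] H) (u : P ⊗[k] (qhsAlg π)),
      mulLeftTensor X a h (LinearMap.lTensor P (crossL t) u) =
      LinearMap.rTensor H (tensorAct P ract)
        ((TensorProduct.assoc k (P ⊗[k] X) (P ⊗[k] (qhsAlg π)) H).symm
        (LinearMap.lTensor (P ⊗[k] X) (TensorProduct.comm k H (P ⊗[k] (qhsAlg π))).toLinearMap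
        (TensorProduct.assoc k (P ⊗[k] X) H (P ⊗[k] (qhsAlg π))
          (mulCoactions H P X ((a ⊗ₜ h) ⊗ₜ t) ⊗ₜ u)))) := by
    intro a h t u
    induction u using TensorProduct.induction_on with
    | zero => simp
    | add u u' hu hu' => simp only [tmul_add, map_add, hu, hu']
    | tmul q c =>
      simp only [crossL, LinearMap.lTensor_tmul, LinearMap.comp_apply, TensorProduct.mk_apply]
      induction t using TensorProduct.induction_on with
      | zero => simp
      | add t t' ht ht' => simp only [tmul_add, add_tmul, map_add, ht, ht']
      | tmul y g => simp
  have hnat : ∀ z : (P ⊗[k] X) ⊗[k] H,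
      LinearMap.rTensor H (tensorAct P ract ∘ₗ LinearMap.lTensor (P ⊗[k] X) coactB)
        ((TensorProduct.assoc k (P ⊗[k] X) (qhsAlg π) H).symm
        (LinearMap.lTensor (P ⊗[k] X) (TensorProduct.comm k H (qhsAlg π)).toLinearMap
        (TensorProduct.assoc k (P ⊗[k] X) H (qhsAlg π) (z ⊗ₜ b)))) =
      LinearMap.rTensor H (tensorAct P ract)
        ((TensorProduct.assoc k (P ⊗[k] X) (P ⊗[k] (qhsAlg π)) H).symm
        (LinearMap.lTensor (P ⊗[k] X) (TensorProduct.comm k H (P ⊗[k] (qhsAlg π))).toLinearMap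
        (TensorProduct.assoc k (P ⊗[k] X) H (P ⊗[k] (qhsAlg π)) (z ⊗ₜ coactB b)))) := by
    intro z
    induction z using TensorProduct.induction_on with
    | zero => simp
    | add z z' hz hz' => simp only [add_tmul, map_add, hz, hz']
    | tmul y h => simp
  rw [hcoact, hnat]
  generalize piCoact π p = s
  induction s using TensorProduct.induction_on with
  | zero => simp
  | add s s' hs hs' =>
    have hadd : LinearMap.mulLeft k (s + s') = LinearMap.mulLeft k s + LinearMap.mulLeft k s' :=
      LinearMap.ext fun w => add_mul s s' w
    simp only [hadd, LinearMap.add_comp, TensorProduct.map_add_left, LinearMap.add_apply,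
      add_tmul, map_add, hs, hs']
  | tmul a h =>
    rw [hleft, ← hco.coassoc, ← LinearMap.lTensor_comp_apply, hcross, hright]

end Crossed

/-- If `X` is a crossed `(H,B)`-module, then `P ⊗ X` with the left
regular `P`-module and `P`-comodule structures on the factor `P`, the tensor
product right `B`-module structure `(p⊗x)◁b = pb₁ ⊗ x◁b₂` and the tensor product
right `H`-comodule structure `p⊗x ↦ p₁⊗x₍₀₎ ⊗ π(p₂)x₍₁₎`, has all four structures
pairwise compatible. -/
theorem tensor_crossedMod_pphb (π : P →ₐc[k] H) (hπ : Function.Surjective π)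
    (coactB : (qhsAlg π) →ₗ[k] P ⊗[k] (qhsAlg π))
    (hco : IsRestrictedComul π coactB)
    {X : Type} [AddCommGroup X] [Module k X]
    (ract : X ⊗[k] (qhsAlg π) →ₗ[k] X) (ρ : X →ₗ[k] X ⊗[k] H)
    (h1 : IsRightAction ract) (h2 : IsRightCoaction ρ)
    (h3 : IsCrossedPair π coactB ract ρ) :
    ∃ D : PPHBStr π coactB (P ⊗[k] X),
      D.lact = (LinearMap.rTensor X (LinearMap.mul' k P)) ∘ₗ
          (TensorProduct.assoc k P P X).symm.toLinearMap ∧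
      D.ract = (TensorProduct.map (LinearMap.mul' k P) ract) ∘ₗ
          (tensorTensorTensorComm k P X P (qhsAlg π)).toLinearMap ∘ₗ
          (LinearMap.lTensor (P ⊗[k] X) coactB) ∧
      D.lam = (TensorProduct.assoc k P P X).toLinearMap ∘ₗ
          (LinearMap.rTensor X (Coalgebra.comul (R := k) (A := P))) ∧
      D.ρ = (LinearMap.lTensor (P ⊗[k] X) (LinearMap.mul' k H)) ∘ₗ
          (tensorTensorTensorComm k P H X H).toLinearMap ∘ₗ
          (TensorProduct.map (piCoact π) ρ) := by
  exact ⟨{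
    lact := regularAct k P X
    ract := tensorAct P ract ∘ₗ LinearMap.lTensor (P ⊗[k] X) coactB
    lam := regularCoact k P X
    ρ := tensorCoact π ρ
    lact_action := isLeftAction_regularAct
    ract_action := isRightAction_tensorAct_coact hco h1
    lam_coaction := isLeftCoaction_regularCoact
    ρ_coaction := (isRightCoaction_piCoact π).tensor h2
    acts_comm := fun p y b => tensorAct_regularAct ract p y (coactB b)
    coacts_comm := regularCoact_tensorCoact π ρ
    lact_lam := regularCoact_regularAct
    lact_ρ := tensorCoact_regularAct π ρ
    ract_lam := regularCoact_tensorAct hco ract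
    ract_ρ := tensorCoact_tensorAct hco h3 }, rfl, rfl, rfl, rfl⟩
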